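/- For every partition μ = (μ₁ ≥ … ≥ μ_n ≥ 0), the Schubert polynomial of the permutation w(μ) equals the Schur polynomial of μ: S_{w(μ)} = Σ_Y x^Y, the sum over all semistandard Young tableaux Y of shape μ with entries in {1,…,n}. -/

import Mathlib

open scoped Classical

noncomputable section

namespace RCGraphs

/-- The simple transposition `s j`, interchanging `j` and `j+1`. -/
def sT (j : ℤ) : Equiv.Perm ℤ := Equiv.swap j (j + 1)

/-- The Coxeter length of a permutation of `ℤ`: the minimal length of an expression
as a product of simple transpositions. -/
def len (w : Equiv.Perm ℤ) : ℕ :=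
  sInf {m : ℕ | ∃ l : List ℤ, l.length = m ∧ (l.map sT).prod = w}

/-- The permutations considered in the paper: bijections of `ℤ` fixing every `i > n`
and fixing all sufficiently small integers. -/
def IsPermZ (n : ℤ) (w : Equiv.Perm ℤ) : Prop :=
  (∀ i : ℤ, n < i → w i = i) ∧ ∃ N : ℤ, ∀ i : ℤ, i < N → w i = i

/-- The reading order on positions `(i,k)`: rows (second coordinate) from `n` downward,
and within a row in order of increasing first coordinate. -/
def rcOrder (p q : ℤ × ℤ) : Prop :=
  q.2 < p.2 ∨ (p.2 = q.2 ∧ p.1 ≤ q.1)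

instance : DecidableRel rcOrder := fun p q => by
  unfold rcOrder; infer_instance

instance : IsTrans (ℤ × ℤ) rcOrder :=
  ⟨fun a b c h₁ h₂ => by unfold rcOrder at *; omega⟩

instance : IsAntisymm (ℤ × ℤ) rcOrder :=
  ⟨fun a b h₁ h₂ => by
    unfold rcOrder at *
    have h3 : a.1 = b.1 ∧ a.2 = b.2 := by omega
    exact Prod.ext h3.1 h3.2⟩

instance : IsTotal (ℤ × ℤ) rcOrder :=
  ⟨fun a b => by unfold rcOrder; omega⟩

/-- The permutation `w_R` associated to a finite set of positions `R`: the product of the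
simple transpositions `s_{i+k-n-1}`, `(i,k) ∈ R`, in the reading order. -/
def wR (n : ℤ) (R : Finset (ℤ × ℤ)) : Equiv.Perm ℤ :=
  ((R.sort rcOrder).map fun p => sT (p.1 + p.2 - n - 1)).prod

/-- `R` is an rc-graph: positions lie in the grid `{(i,k) : i ≤ n, k ≤ n}` and the
reading word is reduced. -/
def IsRC (n : ℤ) (R : Finset (ℤ × ℤ)) : Prop :=
  (∀ p ∈ R, p.1 ≤ n ∧ p.2 ≤ n) ∧ len (wR n R) = R.card

/-- Condition (*): `w_R(i) > w_R(i-1)` for all `i ≤ 0`; equivalently no two strands with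
nonpositive labels cross. -/
def Star (n : ℤ) (R : Finset (ℤ × ℤ)) : Prop :=
  ∀ i : ℤ, i ≤ 0 → wR n R (i - 1) < wR n R i

/-- Strand labels in the wiring diagram of `R` (for diagrams all of whose crossings lie in
rows `k ≥ 1`, as is the case under condition (*)).  `lab n R true i k` is the label of the
strand entering position `(i,k)` from the west (the strand passing above, if `(i,k)` is not
a crossing); `lab n R false i k` is the label of the strand entering from the south (the
strand passing below).  Each strand is labeled by the row where it begins. -/
def lab (n : ℤ) (R : Finset (ℤ × ℤ)) : Bool → ℤ → ℤ → ℤ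
  | true, i, k =>
      if h : n ≤ i then k
      else if (i + 1, k) ∈ R then lab n R true (i + 1) k else lab n R false (i + 1) k
  | false, i, k =>
      if h : k ≤ 0 then i + k - n - 1
      else if (i, k - 1) ∈ R then lab n R false i (k - 1) else lab n R true i (k - 1)
  termination_by b i k => ((n - i).toNat + k.toNat)
  decreasing_by
    all_goals simp_wf
    all_goals omega

/-- The label of the strand leaving position `(i,r)` northward. -/
def northLabel (n : ℤ) (R : Finset (ℤ × ℤ)) (i r : ℤ) : ℤ :=
  if (i, r) ∈ R then lab n R false i r else lab n R true i r

/-- `(i,k)` is an open space: not a crossing, the strand passing below it has a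
nonpositive label and the strand passing above it has a positive label. -/
def OpenSpace (n : ℤ) (R : Finset (ℤ × ℤ)) (i k : ℤ) : Prop :=
  i ≤ n ∧ (i, k) ∉ R ∧ lab n R false i k ≤ 0 ∧ 0 < lab n R true i k

/-- The main loop of the Bergeron--Billey insertion algorithm, recording the trace:
the list of pairs (current diagram, crossing just added).  `R` always contains the
crossing `p` that was just added. -/
def insertSteps (n : ℤ) : ℕ → Finset (ℤ × ℤ) → ℤ × ℤ → List (Finset (ℤ × ℤ) × (ℤ × ℤ))
  | 0, _, _ => []
  | fuel + 1, R, p =>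
      (R, p) ::
        if IsRC n R then []
        else
          let a := lab n R true p.1 p.2
          let b := lab n R false p.1 p.2
          -- the unique other crossing of the two strands that cross at `p`
          let C := R.filter fun q =>
            q ≠ p ∧ ((lab n R true q.1 q.2 = a ∧ lab n R false q.1 q.2 = b) ∨
                     (lab n R true q.1 q.2 = b ∧ lab n R false q.1 q.2 = a))
          let q := (C.sort rcOrder).headI
          let R' := R.erase q
          let i' := sInf {x : ℤ | q.1 < x ∧ OpenSpace n R' x q.2}
          insertSteps n fuel (insert (i', q.2) R') (i', q.2)

/-- The trace of the insertion of `k` into `R`: the states of the algorithm together with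
the crossings added at each step. -/
def insertStepsOf (n : ℤ) (R : Finset (ℤ × ℤ)) (k : ℤ) : List (Finset (ℤ × ℤ) × (ℤ × ℤ)) :=
  let i₁ := sInf {x : ℤ | OpenSpace n R x k}
  insertSteps n ((n + 1 - k).toNat + 1) (insert (i₁, k) R) (i₁, k)

/-- The insertion `R ← k` of Bergeron and Billey. -/
def insertOne (n : ℤ) (R : Finset (ℤ × ℤ)) (k : ℤ) : Finset (ℤ × ℤ) :=
  ((insertStepsOf n R k).getLast?.getD (R, (0, 0))).1

/-- The insertion `R ← v` of a word. -/
def insertWord (n : ℤ) (R : Finset (ℤ × ℤ)) (v : List ℕ) : Finset (ℤ × ℤ) :=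
  v.foldl (fun S a => insertOne n S (a : ℤ)) R

/-- The column (first coordinate) at which the strand labeled `a` of the diagram `R`
leaves row `r` northward. -/
def strandCol (n : ℤ) (R : Finset (ℤ × ℤ)) (a r : ℤ) : ℤ :=
  sSup {i : ℤ | i ≤ n ∧ northLabel n R i r = a}

/-- Given the trace `L` of an insertion, the column occupied in row `r` by the left path
(`left = true`) or the right path (`left = false`) of the insertion.  Between the rows of
the `t`-th and `(t+1)`-st added crossings, the left path is the piece `s_t` of the strand
whose label changes from `a_t` to `b_t`, and the right path is the piece `s^t` whose label
changes from `b_t` to `a_t`. -/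
def pathCol (n : ℤ) (L : List (Finset (ℤ × ℤ) × (ℤ × ℤ))) (left : Bool) (r : ℤ) : ℤ :=
  match (L.filter fun e => e.2.2 ≤ r).getLast? with
  | some e => strandCol n e.1 (lab n e.1 left e.2.1 e.2.2) r
  | none => 0

/-- A semistandard Young tableau with at most `n` rows (rows indexed `1,…,n`, row `j`
having `μ j` boxes, columns indexed from `0`), with entries in `{1,…,n}`, weakly
increasing along rows and strictly increasing down columns; entries outside the shape
are `0`. -/
structure SSYT (n : ℕ) (μ : ℕ → ℕ) where
  entry : ℕ → ℕ → ℕ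
  entry_mem : ∀ j c, 1 ≤ j → j ≤ n → c < μ j → 1 ≤ entry j c ∧ entry j c ≤ n
  row_weak : ∀ j c₁ c₂, 1 ≤ j → j ≤ n → c₁ ≤ c₂ → c₂ < μ j → entry j c₁ ≤ entry j c₂
  col_strict : ∀ j₁ j₂ c, 1 ≤ j₁ → j₁ < j₂ → j₂ ≤ n → c < μ j₂ → entry j₁ c < entry j₂ c
  outside : ∀ j c, j = 0 ∨ n < j ∨ μ j ≤ c → entry j c = 0

/-- `μ` is a partition with (at most) `n` parts `μ 1 ≥ μ 2 ≥ … ≥ μ n ≥ 0`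
(and `μ j = 0` outside `1,…,n`). -/
def IsPartition (n : ℕ) (μ : ℕ → ℕ) : Prop :=
  (∀ j, 1 ≤ j → j < n → μ (j + 1) ≤ μ j) ∧ ∀ j, j = 0 ∨ n < j → μ j = 0

/-- The reading word of a tableau: the rows read left to right, from the bottom row
to the top one. -/
def readingWord (n : ℕ) (μ : ℕ → ℕ) (Y : SSYT n μ) : List ℕ :=
  ((List.range n).reverse.map (· + 1)).flatMap fun j =>
    (List.range (μ j)).map fun c => Y.entry j c

/-- An elementary Knuth move. -/
def KnuthMove (w₁ w₂ : List ℕ) : Prop :=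
  (∃ (u v : List ℕ) (x y z : ℕ), x < y ∧ y ≤ z ∧
      w₁ = u ++ y :: x :: z :: v ∧ w₂ = u ++ y :: z :: x :: v) ∨
  (∃ (u v : List ℕ) (x y z : ℕ), x ≤ y ∧ y < z ∧
      w₁ = u ++ x :: z :: y :: v ∧ w₂ = u ++ z :: x :: y :: v)

/-- Knuth equivalence: the equivalence relation generated by elementary Knuth moves. -/
def KnuthEquiv (w₁ w₂ : List ℕ) : Prop := Relation.EqvGen KnuthMove w₁ w₂

/-- The monomial `x^R = ∏_{(i,k) ∈ R} x_k`. -/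
def xR (R : Finset (ℤ × ℤ)) : MvPolynomial ℕ ℤ :=
  ∏ p ∈ R, MvPolynomial.X p.2.toNat

/-- The monomial `x^Y = ∏ x_i`, one factor for each entry `i` of `Y`. -/
def xY (n : ℕ) (μ : ℕ → ℕ) (Y : SSYT n μ) : MvPolynomial ℕ ℤ :=
  ((readingWord n μ Y).map MvPolynomial.X).prod

/-- The Schubert polynomial `S_w = Σ_{R : w_R = w} x^R`. -/
def Schub (n : ℤ) (w : Equiv.Perm ℤ) : MvPolynomial ℕ ℤ :=
  ∑ᶠ R ∈ {R : Finset (ℤ × ℤ) | IsRC n R ∧ wR n R = w}, xR R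

/-- The Schur polynomial `s_μ(x₁,…,x_n) = Σ_Y x^Y`, summing over all semistandard Young
tableaux of shape `μ` with entries in `{1,…,n}`. -/
def SchurP (n : ℕ) (μ : ℕ → ℕ) : MvPolynomial ℕ ℤ :=
  ∑ᶠ Y : SSYT n μ, xY n μ Y

/-- The complete homogeneous symmetric polynomial
`h_m = Σ_{1 ≤ i₁ ≤ … ≤ i_m ≤ n} x_{i₁} ⋯ x_{i_m}`. -/
def hPoly (n m : ℕ) : MvPolynomial ℕ ℤ :=
  ∑ s ∈ (Finset.Icc 1 n).sym m, (s.1.map MvPolynomial.X).prod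

/-- The top rc-graph `R(μ) = {(i,k) : 1 ≤ k ≤ n, n - μ_k + 1 ≤ i ≤ n}` of a partition. -/
def Rmu (n : ℕ) (μ : ℕ → ℕ) : Finset (ℤ × ℤ) :=
  (Finset.Icc 1 (n : ℤ)).biUnion fun k =>
    (Finset.Icc ((n : ℤ) - μ k.toNat + 1) (n : ℤ)).image fun i => (i, k)


/-- `lam` is a partition shape with rows indexed by `1,…,n`. -/
structure Shape (n : ℕ) (lam : ℕ → ℕ) : Prop where
  anti : ∀ j j', 1 ≤ j → j ≤ j' → lam j' ≤ lam j
  zero : ∀ j, j = 0 ∨ n < j → lam j = 0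

/-- `Y` is a semistandard filling of the shape `lam`. -/
structure Fill (n : ℕ) (lam : ℕ → ℕ) (Y : ℕ → ℕ → ℕ) : Prop where
  shape : Shape n lam
  mem : ∀ j c, 1 ≤ j → j ≤ n → c < lam j → 1 ≤ Y j c ∧ Y j c ≤ n
  row : ∀ j c₁ c₂, 1 ≤ j → j ≤ n → c₁ ≤ c₂ → c₂ < lam j → Y j c₁ ≤ Y j c₂
  col : ∀ j₁ j₂ c, 1 ≤ j₁ → j₁ < j₂ → j₂ ≤ n → c < lam j₂ → Y j₁ c < Y j₂ c

def boxes (n : ℕ) (lam : ℕ → ℕ) : Finset (Σ _ : ℕ, ℕ) :=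
  (Finset.Icc 1 n).sigma fun j => Finset.range (lam j)

def pos (n : ℕ) (Y : ℕ → ℕ → ℕ) (b : Σ _ : ℕ, ℕ) : ℤ × ℤ :=
  ((n : ℤ) + b.1 - b.2 - Y b.1 b.2, (Y b.1 b.2 : ℤ))

def P (n : ℕ) (lam : ℕ → ℕ) (Y : ℕ → ℕ → ℕ) : Finset (ℤ × ℤ) :=
  (boxes n lam).image (pos n Y)

lemma mem_boxes {n : ℕ} {lam : ℕ → ℕ} {b : Σ _ : ℕ, ℕ} :
    b ∈ boxes n lam ↔ (1 ≤ b.1 ∧ b.1 ≤ n) ∧ b.2 < lam b.1 := by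
  simp [boxes]

lemma mem_P {n : ℕ} {lam : ℕ → ℕ} {Y : ℕ → ℕ → ℕ} {p : ℤ × ℤ} :
    p ∈ P n lam Y ↔ ∃ j c, (1 ≤ j ∧ j ≤ n) ∧ c < lam j ∧ pos n Y ⟨j, c⟩ = p := by
  simp only [P, Finset.mem_image, mem_boxes]
  constructor
  · rintro ⟨⟨j, c⟩, ⟨h1, h2⟩, h3⟩; exact ⟨j, c, h1, h2, h3⟩
  · rintro ⟨j, c, h1, h2, h3⟩; exact ⟨⟨j, c⟩, ⟨h1, h2⟩, h3⟩

lemma pos_inj' {n : ℕ} {lam : ℕ → ℕ} {Y : ℕ → ℕ → ℕ} (h : Fill n lam Y) (j c j' c' : ℕ)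
    (hj : 1 ≤ j) (hj' : j' ≤ n) (hc' : c' < lam j')
    (hp : pos n Y ⟨j, c⟩ = pos n Y ⟨j', c'⟩) : ¬ j < j' := by
  intro hlt
  simp only [pos, Prod.mk.injEq] at hp
  have h1 := h.shape.anti j j' hj hlt.le
  have h2 := h.row j c c' hj (by omega) (by omega) (by omega)
  have h3 := h.col j j' c' hj hlt hj' hc'
  omega

lemma pos_inj {n : ℕ} {lam : ℕ → ℕ} {Y : ℕ → ℕ → ℕ} (h : Fill n lam Y) :
    Set.InjOn (pos n Y) (boxes n lam : Set (Σ _ : ℕ, ℕ)) := by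
  rintro ⟨j, c⟩ hb ⟨j', c'⟩ hb' hp
  rw [Finset.mem_coe, mem_boxes] at hb hb'
  dsimp only at hb hb'
  have h1 := pos_inj' h j c j' c' hb.1.1 hb'.1.2 hb'.2 hp
  have h2 := pos_inj' h j' c' j c hb'.1.1 hb.1.2 hb.2 hp.symm
  have h3 : j = j' := by omega
  subst h3
  simp only [pos, Prod.mk.injEq] at hp
  have h4 : c = c' := by omega
  rw [h4]

lemma card_P {n : ℕ} {lam : ℕ → ℕ} {Y : ℕ → ℕ → ℕ} (h : Fill n lam Y) :
    (P n lam Y).card = ∑ j ∈ Finset.Icc 1 n, lam j := by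
  rw [P, Finset.card_image_of_injOn (pos_inj h)]
  simp [boxes]

/-- `w` is the Grassmannian permutation attached to `lam`. -/
def Grass (w : Equiv.Perm ℤ) (lam : ℕ → ℕ) : Prop :=
  (∀ j : ℕ, 1 ≤ j → w (j : ℤ) = j - lam j) ∧ ∀ x y : ℤ, x < y → y ≤ 0 → w x < w y

lemma sT_apply (a x : ℤ) : sT a x = if x = a then a + 1 else if x = a + 1 then a else x := by
  rw [sT, Equiv.swap_apply_def]

lemma grass_step {n : ℕ} {w : Equiv.Perm ℤ} {lam : ℕ → ℕ} (hs : Shape n lam) (hg : Grass w lam)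
    (j : ℕ) (hj : 1 ≤ j) (hc : j = 1 ∨ lam j < lam (j - 1)) :
    Grass (sT ((j : ℤ) - 1 - lam j) * w) (Function.update lam j (lam j + 1)) := by
  have hwj := hg.1 j hj
  refine ⟨?_, ?_⟩
  · intro i hi
    have hwi := hg.1 i hi
    rw [Equiv.Perm.mul_apply, sT_apply, Function.update_apply]
    rcases lt_trichotomy i j with h | h | h
    · have h1 := hs.anti i (j - 1) hi (by omega)
      have h2 : lam j < lam (j - 1) := by omega
      rw [if_neg (by omega), if_neg (by omega), if_neg (by omega)]
      omega
    · subst h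
      rw [if_neg (by omega), if_pos (by omega), if_pos rfl]
      push_cast; omega
    · have h1 := hs.anti j i hj h.le
      rw [if_neg (by omega), if_neg (by omega), if_neg (by omega)]
      omega
  · intro x y hxy hy
    have h := hg.2 x y hxy hy
    have hne : ∀ z : ℤ, z ≤ 0 → w z ≠ (j : ℤ) - 1 - lam j + 1 := by
      intro z hz hw
      have : w z = w j := by rw [hw, hwj]; ring
      have := w.injective this
      omega
    have h1 := hne x (by omega)
    have h2 := hne y hy
    rw [Equiv.Perm.mul_apply, Equiv.Perm.mul_apply, sT_apply, sT_apply]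
    split_ifs <;> omega

lemma grass_unique {w w' : Equiv.Perm ℤ} {lam : ℕ → ℕ} (h : Grass w lam) (h' : Grass w' lam) :
    w = w' := by
  have hpos : ∀ x : ℤ, 0 < x → w x = w' x := by
    intro x hx
    obtain ⟨j, rfl⟩ := Int.eq_ofNat_of_zero_le hx.le
    rw [h.1 j (by omega), h'.1 j (by omega)]
  have hm : ∀ {v : Equiv.Perm ℤ}, Grass v lam → StrictMono (fun m : ℕ => - v (-(m : ℤ))) := by
    intro v hv a b hab
    have := hv.2 (-(b : ℤ)) (-(a : ℤ)) (by omega) (by omega)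
    dsimp only; omega
  have hr : ∀ {v v' : Equiv.Perm ℤ}, (∀ x : ℤ, 0 < x → v x = v' x) →
      Set.range (fun m : ℕ => - v (-(m : ℤ))) ⊆ Set.range (fun m : ℕ => - v' (-(m : ℤ))) := by
    rintro v v' hv _ ⟨m, rfl⟩
    obtain ⟨z, hz⟩ := v'.surjective (v (-(m : ℤ)))
    have hz0 : z ≤ 0 := by
      by_contra hcon
      have h1 := hv z (by omega)
      rw [hz] at h1
      have := v.injective h1
      omega
    refine ⟨(-z).toNat, ?_⟩
    have : -(((-z).toNat : ℕ) : ℤ) = z := by omega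
    dsimp only
    rw [this, hz]
  have heq := ((hm h).range_inj (hm h')).1
    (Set.Subset.antisymm (hr hpos) (hr fun x hx => (hpos x hx).symm))
  ext x
  by_cases hx : 0 < x
  · exact hpos x hx
  · have := congrFun heq (-x).toNat
    have h2 : -(((-x).toNat : ℕ) : ℤ) = x := by omega
    rw [h2] at this
    omega

lemma grass_shape_unique {n : ℕ} {w : Equiv.Perm ℤ} {lam lam' : ℕ → ℕ} (hs : Shape n lam)
    (hs' : Shape n lam') (h : Grass w lam) (h' : Grass w lam') : lam = lam' := by
  funext j
  by_cases hj : j = 0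
  · rw [hs.zero j (Or.inl hj), hs'.zero j (Or.inl hj)]
  · have h1 := h.1 j (by omega)
    have h2 := h'.1 j (by omega)
    omega

/-! Energy. -/

def En (n : ℕ) (w : Equiv.Perm ℤ) : ℤ := ∑ j ∈ Finset.Icc 1 n, ((j : ℤ) - w j)

lemma en_step_eq (n : ℕ) (a : ℤ) (w : Equiv.Perm ℤ) :
    En n (sT a * w) = En n w + ((Finset.Icc 1 n).filter fun j : ℕ => w j = a + 1).card
      - ((Finset.Icc 1 n).filter fun j : ℕ => w j = a).card := by
  rw [Finset.card_filter, Finset.card_filter]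
  push_cast
  rw [En, En, ← Finset.sum_add_distrib, ← Finset.sum_sub_distrib]
  refine Finset.sum_congr rfl fun j _ => ?_
  rw [Equiv.Perm.mul_apply, sT_apply]
  split_ifs <;> omega

lemma en_card (n : ℕ) (a : ℤ) (w : Equiv.Perm ℤ) :
    ((Finset.Icc 1 n).filter fun j : ℕ => w j = a).card ≤ 1 := by
  rw [Finset.card_le_one]
  intro x hx y hy
  rw [Finset.mem_filter] at hx hy
  have := w.injective (hx.2.trans hy.2.symm)
  exact_mod_cast this

lemma en_step_le (n : ℕ) (a : ℤ) (w : Equiv.Perm ℤ) : En n (sT a * w) ≤ En n w + 1 := by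
  have h1 := en_step_eq n a w
  have h2 := en_card n (a + 1) w
  omega

lemma en_step_add (n : ℕ) (a : ℤ) (w : Equiv.Perm ℤ) (h : En n (sT a * w) = En n w + 1) :
    (∃ j : ℕ, 1 ≤ j ∧ j ≤ n ∧ w j = a + 1) ∧ ∀ j : ℕ, 1 ≤ j → j ≤ n → w j ≠ a := by
  have h1 := en_step_eq n a w
  have h2 := en_card n (a + 1) w
  constructor
  · have : 0 < ((Finset.Icc 1 n).filter fun j : ℕ => w j = a + 1).card := by omega
    obtain ⟨j, hj⟩ := Finset.card_pos.1 this
    rw [Finset.mem_filter, Finset.mem_Icc] at hj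
    exact ⟨j, hj.1.1, hj.1.2, hj.2⟩
  · intro j hj hjn hw
    have h3 : ((Finset.Icc 1 n).filter fun j : ℕ => w j = a).card = 0 := by omega
    rw [Finset.card_eq_zero] at h3
    have : j ∈ (Finset.Icc 1 n).filter fun j : ℕ => w j = a := by
      rw [Finset.mem_filter, Finset.mem_Icc]; exact ⟨⟨hj, hjn⟩, hw⟩
    rw [h3] at this
    simp at this

lemma en_one (n : ℕ) : En n 1 = 0 := by simp [En]

lemma en_le (n : ℕ) (l : List ℤ) : En n (l.map sT).prod ≤ l.length := by
  induction l with
  | nil => simp [en_one]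
  | cons a t ih =>
    have := en_step_le n a (t.map sT).prod
    rw [List.map_cons, List.prod_cons, List.length_cons]
    push_cast
    omega

lemma en_wR_le (n : ℕ) (R : Finset (ℤ × ℤ)) : En n (wR n R) ≤ R.card := by
  have := en_le n ((R.sort rcOrder).map fun p => p.1 + p.2 - n - 1)
  rw [List.map_map, List.length_map, Finset.length_sort] at this
  exact this

lemma en_grass {n : ℕ} {w : Equiv.Perm ℤ} {lam : ℕ → ℕ} (h : Grass w lam) :
    En n w = ((∑ j ∈ Finset.Icc 1 n, lam j : ℕ) : ℤ) := by
  rw [En]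
  push_cast
  refine Finset.sum_congr rfl fun j hj => ?_
  rw [h.1 j (Finset.mem_Icc.1 hj).1]
  ring

/-! Removing the first element of the reading order. -/

lemma wR_empty (n : ℤ) : wR n ∅ = 1 := by simp [wR]

lemma wR_erase (n : ℤ) (R : Finset (ℤ × ℤ)) (p : ℤ × ℤ) (hp : p ∈ R)
    (hmin : ∀ q ∈ R, rcOrder p q) :
    wR n R = sT (p.1 + p.2 - n - 1) * wR n (R.erase p) := by
  have h := Finset.sort_insert (r := rcOrder) (a := p) (s := R.erase p)
    (fun b hb => hmin b (Finset.mem_of_mem_erase hb)) (Finset.notMem_erase p R)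
  rw [Finset.insert_erase hp] at h
  rw [wR, h, List.map_cons, List.prod_cons, wR]

lemma exists_first (R : Finset (ℤ × ℤ)) (hR : R.Nonempty) : ∃ p ∈ R, ∀ q ∈ R, rcOrder p q := by
  have hs := Finset.pairwise_sort R rcOrder
  have hm : ∀ q, q ∈ R.sort rcOrder ↔ q ∈ R := fun q => Finset.mem_sort rcOrder
  have hl : (R.sort rcOrder).length = R.card := Finset.length_sort rcOrder
  cases hL : R.sort rcOrder with
  | nil =>
    rw [hL] at hl
    have := Finset.card_pos.2 hR
    simp at hl; omega
  | cons p t =>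
    rw [hL] at hs hm
    refine ⟨p, (hm p).1 (by simp), fun q hq => ?_⟩
    have := (hm q).2 hq
    rcases List.mem_cons.1 this with h | h
    · subst h; right; exact ⟨rfl, le_refl _⟩
    · exact (List.pairwise_cons.1 hs).1 q h

lemma fill_extract {n : ℕ} {lam : ℕ → ℕ} {Y : ℕ → ℕ → ℕ} (h : Fill n lam Y) (p : ℤ × ℤ)
    (hp : p ∈ P n lam Y) (hmin : ∀ q ∈ P n lam Y, rcOrder p q) :
    ∃ j, 1 ≤ j ∧ j ≤ n ∧ 1 ≤ lam j ∧ lam (j + 1) < lam j ∧ p = pos n Y ⟨j, lam j - 1⟩ ∧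
      Fill n (Function.update lam j (lam j - 1)) Y ∧
      P n (Function.update lam j (lam j - 1)) Y = (P n lam Y).erase p := by
  obtain ⟨j, c, ⟨hj, hjn⟩, hc, rfl⟩ := mem_P.1 hp
  have h1 : c = lam j - 1 := by
    by_contra hne
    have hc' : c + 1 < lam j := by omega
    have h2 := hmin _ (mem_P.2 ⟨j, c + 1, ⟨hj, hjn⟩, hc', rfl⟩)
    have h3 := h.row j c (c + 1) hj hjn (by omega) hc'
    simp only [rcOrder, pos] at h2
    push_cast at h2
    omega
  have h2 : lam (j + 1) < lam j := by
    by_contra hne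
    have hn : j + 1 ≤ n := by
      by_contra hcon
      have := h.shape.zero (j + 1) (by omega)
      omega
    have hc' : c < lam (j + 1) := by omega
    have h2 := hmin _ (mem_P.2 ⟨j + 1, c, ⟨by omega, hn⟩, hc', rfl⟩)
    have h3 := h.col j (j + 1) c hj (by omega) hn hc'
    simp only [rcOrder, pos] at h2
    push_cast at h2
    omega
  subst h1
  have hle : ∀ i, Function.update lam j (lam j - 1) i ≤ lam i := by
    intro i
    rw [Function.update_apply]
    split_ifs with hi
    · subst hi; omega
    · exact le_rfl
  refine ⟨j, hj, hjn, by omega, h2, rfl, ⟨⟨?_, ?_⟩, ?_, ?_, ?_⟩, ?_⟩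
  · intro i i' hi hii
    have h3 := h.shape.anti i i' hi hii
    rw [Function.update_apply, Function.update_apply]
    split_ifs with ha hb hb
    · exact le_rfl
    · subst ha; omega
    · subst hb
      have := h.shape.anti (i + 1) i' (by omega) (by omega)
      omega
    · exact h3
  · intro i hi
    have := h.shape.zero i hi
    have := hle i
    omega
  · intro i c h3 h4 h5
    exact h.mem i c h3 h4 (h5.trans_le (hle i))
  · intro i c c' h3 h4 h5 h6
    exact h.row i c c' h3 h4 h5 (h6.trans_le (hle i))
  · intro i i' c h3 h4 h5 h6
    exact h.col i i' c h3 h4 h5 (h6.trans_le (hle i'))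
  · ext q
    rw [Finset.mem_erase, mem_P, mem_P]
    constructor
    · rintro ⟨i, d, hi, hd, rfl⟩
      refine ⟨?_, i, d, hi, hd.trans_le (hle i), rfl⟩
      intro heq
      have := pos_inj h (mem_boxes.2 ⟨hi, hd.trans_le (hle i)⟩)
        (mem_boxes.2 ⟨⟨hj, hjn⟩, hc⟩) heq
      injection this with h3 h4
      have h5 : d = lam j - 1 := by simpa using h4
      have h3 : i = j := h3
      subst h3
      rw [Function.update_self] at hd
      omega
    · rintro ⟨hne, i, d, hi, hd, rfl⟩
      refine ⟨i, d, hi, ?_, rfl⟩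
      rw [Function.update_apply]
      split_ifs with hij
      · subst hij
        by_contra hcon
        have : d = lam i - 1 := by omega
        subst this
        exact hne rfl
      · exact hd

lemma fill_zero {n : ℕ} {lam : ℕ → ℕ} {Y : ℕ → ℕ → ℕ} (h : Fill n lam Y)
    (h0 : P n lam Y = ∅) : lam = 0 := by
  funext j
  by_contra hne
  have hne : lam j ≠ 0 := hne
  have h1 : ¬ (j = 0 ∨ n < j) := fun hh => hne (h.shape.zero j hh)
  have : pos n Y ⟨j, 0⟩ ∈ P n lam Y := mem_P.2 ⟨j, 0, by omega, by omega, rfl⟩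
  rw [h0] at this
  simp at this

lemma grass_one : Grass 1 0 := by
  refine ⟨fun j _ => by simp, fun x y h _ => by simpa using h⟩

lemma fill_grass {n : ℕ} (Y : ℕ → ℕ → ℕ) : ∀ (m : ℕ) (lam : ℕ → ℕ), Fill n lam Y →
    (P n lam Y).card = m → Grass (wR n (P n lam Y)) lam := by
  intro m
  induction m with
  | zero =>
    intro lam h hm
    rw [Finset.card_eq_zero] at hm
    rw [hm, wR_empty, fill_zero h hm]
    exact grass_one
  | succ m ih =>
    intro lam h hm
    obtain ⟨p, hp, hmin⟩ := exists_first (P n lam Y) (Finset.card_pos.1 (by omega))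
    obtain ⟨j, hj, hjn, hl, hlt, hpe, hf, hP⟩ := fill_extract h p hp hmin
    have hg := ih _ hf (by rw [hP, Finset.card_erase_of_mem hp]; omega)
    rw [hP] at hg
    rw [wR_erase n _ p hp hmin]
    have hst := grass_step hf.shape hg j hj (by
      by_cases hj1 : j = 1
      · exact Or.inl hj1
      · right
        rw [Function.update_self, Function.update_of_ne (by omega)]
        have := h.shape.anti (j - 1) j (by omega) (by omega)
        omega)
    rw [Function.update_self, Function.update_idem, Nat.sub_add_cancel hl,
      Function.update_eq_self] at hst
    convert hst using 3
    rw [hpe]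
    simp only [pos]
    push_cast [hl]
    ring

lemma fill_inj {n : ℕ} (Y Y' : ℕ → ℕ → ℕ) : ∀ (m : ℕ) (lam : ℕ → ℕ), Fill n lam Y →
    Fill n lam Y' → P n lam Y = P n lam Y' → (P n lam Y).card = m →
    ∀ j c, c < lam j → Y j c = Y' j c := by
  intro m
  induction m with
  | zero =>
    intro lam h h' he hm j c hc
    rw [Finset.card_eq_zero] at hm
    rw [fill_zero h hm] at hc
    simp at hc
  | succ m ih =>
    intro lam h h' he hm i c hc
    obtain ⟨p, hp, hmin⟩ := exists_first (P n lam Y) (Finset.card_pos.1 (by omega))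
    obtain ⟨j, hj, hjn, hl, hlt, hpe, hf, hP⟩ := fill_extract h p hp hmin
    obtain ⟨j', hj', hjn', hl', hlt', hpe', hf', hP'⟩ :=
      fill_extract h' p (he ▸ hp) (he ▸ hmin)
    have hpp := hpe.symm.trans hpe'
    simp only [pos, Prod.mk.injEq] at hpp
    have hjj : j = j' := by
      rcases lt_trichotomy j j' with hh | hh | hh
      · have := h.shape.anti j j' hj hh.le
        omega
      · exact hh
      · have := h.shape.anti j' j hj' hh.le
        omega
    subst hjj
    by_cases hic : i = j ∧ c = lam j - 1
    · rw [hic.1, hic.2]; exact_mod_cast hpp.2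
    · refine ih _ hf hf' (by rw [hP, hP', he]) (by rw [hP, Finset.card_erase_of_mem hp]; omega)
        i c ?_
      rw [Function.update_apply]
      split_ifs with hij
      · subst hij; omega
      · exact hc

lemma rc_fill {n : ℕ} : ∀ (m : ℕ) (R : Finset (ℤ × ℤ)), R.card = m →
    (∀ p ∈ R, p.1 ≤ n ∧ p.2 ≤ n) → En n (wR n R) = R.card →
    ∃ lam Y, Fill n lam Y ∧ R = P n lam Y ∧ Grass (wR n R) lam := by
  intro m
  induction m with
  | zero =>
    intro R hm _ _
    rw [Finset.card_eq_zero] at hm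
    subst hm
    refine ⟨0, 0, ⟨⟨?_, ?_⟩, ?_, ?_, ?_⟩, ?_, ?_⟩
    · simp
    · simp
    · simp
    · simp
    · simp
    · symm
      rw [Finset.eq_empty_iff_forall_notMem]
      intro q hq
      obtain ⟨j, c, _, hc, _⟩ := mem_P.1 hq
      simp at hc
    · rw [wR_empty]; exact grass_one
  | succ m ih =>
    intro R hm hb hE
    obtain ⟨p, hp, hmin⟩ := exists_first R (Finset.card_pos.1 (by omega))
    have hcard : (R.erase p).card = m := by rw [Finset.card_erase_of_mem hp]; omega
    have hw := wR_erase n R p hp hmin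
    have hle := en_wR_le n (R.erase p)
    have hst := en_step_le n (p.1 + p.2 - n - 1) (wR n (R.erase p))
    rw [← hw] at hst
    have hEe : En n (wR n (R.erase p)) = (R.erase p).card := by omega
    obtain ⟨lam, Y, hF, hP, hG⟩ := ih (R.erase p) hcard
      (fun q hq => hb q (Finset.mem_of_mem_erase hq)) hEe
    obtain ⟨⟨j, hj, hjn, hwj⟩, hna⟩ := en_step_add n (p.1 + p.2 - n - 1) (wR n (R.erase p))
      (by rw [← hw]; omega)
    have hGj := hG.1 j hj
    have ha : p.1 + p.2 - n - 1 = (j : ℤ) - 1 - lam j := by omega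
    have hadd : j = 1 ∨ lam j < lam (j - 1) := by
      by_cases hj1 : j = 1
      · exact Or.inl hj1
      · right
        have h1 := hna (j - 1) (by omega) (by omega)
        have h2 := hG.1 (j - 1) (by omega)
        have h3 := hF.shape.anti (j - 1) j (by omega) (by omega)
        push_cast [hj] at h1 h2
        omega
    have hpb := hb p hp
    -- the new entry dominates all the old ones
    have hdom : ∀ i c, 1 ≤ i → i ≤ n → c < lam i → (Y i c : ℤ) < p.2 ∨
        ((Y i c : ℤ) = p.2 ∧ (j : ℤ) - lam j < i - c) := by
      intro i c hi hin hc
      have hq : pos n Y ⟨i, c⟩ ∈ R.erase p := hP ▸ mem_P.2 ⟨i, c, ⟨hi, hin⟩, hc, rfl⟩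
      have h1 := hmin _ (Finset.mem_of_mem_erase hq)
      have h2 := Finset.ne_of_mem_erase hq
      simp only [rcOrder, pos] at h1
      rw [Ne, Prod.ext_iff] at h2
      simp only [pos] at h2
      omega
    have hk1 : 1 ≤ p.2 := by
      by_cases hl : lam j = 0
      · omega
      · have h1 := hdom j 0 hj hjn (by omega)
        have h2 := hF.mem j 0 hj hjn (by omega)
        omega
    have hk : ((p.2.toNat : ℕ) : ℤ) = p.2 := by omega
    let lam' := Function.update lam j (lam j + 1)
    let Y' : ℕ → ℕ → ℕ := fun i c => if i = j ∧ c = lam j then p.2.toNat else Y i c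
    have hY'n : Y' j (lam j) = p.2.toNat := by simp [Y']
    have hY'o : ∀ i c, c < lam i → Y' i c = Y i c := by
      intro i c hc
      simp only [Y']
      rw [if_neg]
      rintro ⟨rfl, h2⟩
      omega
    have hcase : ∀ i c, c < lam' i → (i = j ∧ c = lam j) ∨ c < lam i := by
      intro i c hc
      simp only [lam', Function.update_apply] at hc
      split_ifs at hc with hij
      · subst hij; omega
      · exact Or.inr hc
    have hlam'j : lam' j = lam j + 1 := by simp [lam']
    have hlam'o : ∀ i, i ≠ j → lam' i = lam i := by
      intro i hi; simp only [lam']; rw [Function.update_of_ne hi]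
    have hF' : Fill n lam' Y' := by
      refine ⟨⟨?_, ?_⟩, ?_, ?_, ?_⟩
      · intro i i' hi hii
        have h3 := hF.shape.anti i i' hi hii
        by_cases h1 : i' = j
        · by_cases h2 : i = j
          · rw [h1, h2]
          · subst h1
            have := hF.shape.anti i (i' - 1) hi (by omega)
            rw [hlam'j, hlam'o i h2]
            omega
        · rw [hlam'o i' h1]
          by_cases h2 : i = j
          · rw [h2, hlam'j]; subst h2; omega
          · rw [hlam'o i h2]; exact h3
      · intro i hi
        rw [hlam'o i (by omega)]
        exact hF.shape.zero i hi
      · intro i c hi hin hc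
        rcases hcase i c hc with ⟨rfl, rfl⟩ | h
        · rw [hY'n]; omega
        · rw [hY'o i c h]; exact hF.mem i c hi hin h
      · intro i c c' hi hin hcc hc'
        rcases hcase i c' hc' with ⟨rfl, rfl⟩ | h
        · rcases hcc.eq_or_lt with rfl | hlt
          · exact le_rfl
          · rw [hY'n, hY'o i c hlt]
            have := hdom i c hi hin hlt
            omega
        · rw [hY'o i c' h, hY'o i c (by omega)]
          exact hF.row i c c' hi hin hcc h
      · intro i i' c hi hii hin hc
        rcases hcase i' c hc with ⟨rfl, rfl⟩ | h
        · have h1 := hF.shape.anti i (i' - 1) hi (by omega)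
          have h2 : lam i' < lam i := by omega
          rw [hY'n, hY'o i _ h2]
          have := hdom i (lam i') hi (by omega) h2
          omega
        · have h1 := hF.shape.anti i i' hi hii.le
          rw [hY'o i' c h, hY'o i c (by omega)]
          exact hF.col i i' c hi hii hin h
    have hposn : pos n Y' ⟨j, lam j⟩ = p := by
      apply Prod.ext
      · simp only [pos]; rw [hY'n]; omega
      · simp only [pos]; rw [hY'n]; omega
    have hposo : ∀ i c, c < lam i → pos n Y' ⟨i, c⟩ = pos n Y ⟨i, c⟩ := by
      intro i c hc
      simp only [pos]; rw [hY'o i c hc]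
    refine ⟨lam', Y', hF', ?_, ?_⟩
    · rw [← Finset.insert_erase hp, hP]
      ext q
      rw [Finset.mem_insert, mem_P, mem_P]
      constructor
      · rintro (rfl | ⟨i, c, hi, hc, rfl⟩)
        · exact ⟨j, lam j, ⟨hj, hjn⟩, by omega, hposn⟩
        · refine ⟨i, c, hi, ?_, hposo i c hc⟩
          by_cases hij : i = j
          · subst hij; omega
          · rw [hlam'o i hij]; exact hc
      · rintro ⟨i, c, hi, hc, rfl⟩
        rcases hcase i c hc with ⟨rfl, rfl⟩ | h
        · exact Or.inl hposn
        · exact Or.inr ⟨i, c, hi, h, (hposo i c h).symm⟩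
    · rw [hw, ha]
      exact grass_step hF.shape hG j hj hadd

/-! Assembling. -/

lemma shape_of_partition {n : ℕ} {μ : ℕ → ℕ} (h : IsPartition n μ) : Shape n μ := by
  refine ⟨?_, h.2⟩
  intro j j' hj hjj
  induction j', hjj using Nat.le_induction with
  | base => exact le_rfl
  | succ k hk ih =>
    refine le_trans ?_ ih
    by_cases hkn : k < n
    · exact h.1 k (by omega) hkn
    · rw [h.2 (k + 1) (by omega)]; exact Nat.zero_le _

lemma ssyt_fill {n : ℕ} {μ : ℕ → ℕ} (h : IsPartition n μ) (Y : SSYT n μ) : Fill n μ Y.entry :=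
  ⟨shape_of_partition h, Y.entry_mem, Y.row_weak, Y.col_strict⟩

lemma Rmu_eq {n : ℕ} {μ : ℕ → ℕ} : Rmu n μ = P n μ (fun j _ => j) := by
  ext ⟨i, k⟩
  rw [mem_P]
  simp only [Rmu, Finset.mem_biUnion, Finset.mem_image, Finset.mem_Icc, pos, Prod.mk.injEq]
  constructor
  · rintro ⟨k', hk', i', hi', rfl, rfl⟩
    refine ⟨k'.toNat, (n - i').toNat, by omega, by omega, by omega, by omega⟩
  · rintro ⟨j, c, hj, hc, hi, rfl⟩
    refine ⟨j, by omega, i, ?_, rfl, rfl⟩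
    rw [Int.toNat_natCast]
    omega

lemma Rmu_fill {n : ℕ} {μ : ℕ → ℕ} (h : IsPartition n μ) : Fill n μ (fun j _ => j) :=
  ⟨shape_of_partition h, fun _ _ h1 h2 _ => ⟨h1, h2⟩, fun _ _ _ _ _ _ _ => le_rfl,
    fun _ _ _ _ h _ _ => h⟩

lemma len_wR {n : ℕ} {lam : ℕ → ℕ} {Y : ℕ → ℕ → ℕ} (h : Fill n lam Y) :
    len (wR n (P n lam Y)) = (P n lam Y).card := by
  apply le_antisymm
  · apply Nat.sInf_le
    refine ⟨((P n lam Y).sort rcOrder).map fun p => p.1 + p.2 - n - 1, ?_, ?_⟩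
    · rw [List.length_map, Finset.length_sort]
    · rw [List.map_map]; rfl
  · refine le_csInf ⟨_, ((P n lam Y).sort rcOrder).map fun p => p.1 + p.2 - n - 1, rfl, ?_⟩ ?_
    · rw [List.map_map]; rfl
    · rintro m ⟨l, rfl, hl⟩
      have h1 := en_le n l
      rw [hl, en_grass (fill_grass Y _ lam h rfl), ← card_P h] at h1
      exact_mod_cast h1

lemma fill_ge {n : ℕ} {lam : ℕ → ℕ} {Y : ℕ → ℕ → ℕ} (h : Fill n lam Y) (j : ℕ) :
    ∀ c, 1 ≤ j → j ≤ n → c < lam j → j ≤ Y j c := by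
  induction j with
  | zero => intro c hj; omega
  | succ j ih =>
    intro c hj hjn hc
    by_cases hj0 : j = 0
    · have := h.mem (j + 1) c hj hjn hc
      omega
    · have h1 := h.shape.anti j (j + 1) (by omega) (by omega)
      have h2 := ih c (by omega) (by omega) (by omega)
      have h3 := h.col j (j + 1) c (by omega) (by omega) hjn hc
      omega

lemma isRC_P {n : ℕ} {lam : ℕ → ℕ} {Y : ℕ → ℕ → ℕ} (h : Fill n lam Y) :
    IsRC n (P n lam Y) := by
  refine ⟨?_, len_wR h⟩
  intro p hp
  obtain ⟨j, c, hj, hc, rfl⟩ := mem_P.1 hp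
  have h1 := fill_ge h j c hj.1 hj.2 hc
  have h2 := h.mem j c hj.1 hj.2 hc
  simp only [pos]
  omega

lemma xR_eq {n : ℕ} {μ : ℕ → ℕ} (h : IsPartition n μ) (Y : SSYT n μ) :
    xR (P n μ Y.entry) = xY n μ Y := by
  rw [xR, P, Finset.prod_image (pos_inj (ssyt_fill h Y)), boxes, Finset.prod_sigma, xY, readingWord]
  have key : ∀ m : ℕ, ∏ j ∈ Finset.Icc 1 m, ∏ c ∈ Finset.range (μ j),
      (MvPolynomial.X (Y.entry j c) : MvPolynomial ℕ ℤ) =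
      (List.map MvPolynomial.X (((List.range m).reverse.map (· + 1)).flatMap fun j =>
        (List.range (μ j)).map fun c => Y.entry j c)).prod := by
    intro m
    induction m with
    | zero => simp
    | succ m ih =>
      rw [Finset.prod_Icc_succ_top (by omega), ih, List.range_succ, List.reverse_append,
        List.map_append, List.flatMap_append, List.map_append, List.prod_append, mul_comm]
      congr 1
      simp only [List.reverse_singleton, List.map_singleton, List.flatMap_singleton, List.map_map]
      rw [Finset.prod_eq_multiset_prod]
      rfl
  rw [← key n]
  simp [pos]

/-- For every partition `μ`, the Schubert polynomial of `w(μ)` equals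
the Schur polynomial of `μ`. -/
theorem schubert_eq_schur (n : ℕ) (hn : 0 < n) (μ : ℕ → ℕ) (hμ : IsPartition n μ) :
    Schub n (wR n (Rmu n μ)) = SchurP n μ := by
  rw [Schub, SchurP, ← finsum_mem_univ (fun Y : SSYT n μ => xY n μ Y)]
  symm
  refine finsum_mem_eq_of_bijOn (fun Y : SSYT n μ => P n μ Y.entry) ⟨?_, ?_, ?_⟩
    (fun Y _ => (xR_eq hμ Y).symm)
  · intro Y _
    have hF := ssyt_fill hμ Y
    refine ⟨isRC_P hF, ?_⟩
    rw [Rmu_eq]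
    exact grass_unique (fill_grass _ _ μ hF rfl) (fill_grass _ _ μ (Rmu_fill hμ) rfl)
  · intro Y _ Y' _ he
    have h1 := fill_inj Y.entry Y'.entry _ μ (ssyt_fill hμ Y) (ssyt_fill hμ Y') he rfl
    have h2 : Y.entry = Y'.entry := by
      funext j c
      by_cases hc : c < μ j
      · exact h1 j c hc
      · rw [Y.outside j c (by omega), Y'.outside j c (by omega)]
    cases Y; cases Y'
    simp only at h2
    subst h2
    rfl
  · rintro R ⟨hR, hw⟩
    have hG := fill_grass _ _ μ (Rmu_fill hμ) rfl
    have hl := len_wR (Rmu_fill hμ)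
    have hc := card_P (Rmu_fill hμ)
    rw [← Rmu_eq, ← hw] at hG hl
    have hE := en_grass (n := n) hG
    rw [← hc, ← Rmu_eq, ← hl, hR.2] at hE
    obtain ⟨lam, Y, hF, hP, hG'⟩ := rc_fill _ R rfl hR.1 hE
    have hlam := grass_shape_unique hF.shape (shape_of_partition hμ) hG' hG
    subst hlam
    have hin : ∀ j c, c < lam j → (if c < lam j then Y j c else 0) = Y j c :=
      fun j c h => if_pos h
    refine ⟨⟨fun j c => if c < lam j then Y j c else 0, ?_, ?_, ?_, ?_⟩, trivial, ?_⟩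
    · intro j c h1 h2 h3
      rw [hin j c h3]; exact hF.mem j c h1 h2 h3
    · intro j c c' h1 h2 h3 h4
      rw [hin j c (by omega), hin j c' h4]; exact hF.row j c c' h1 h2 h3 h4
    · intro j j' c h1 h2 h3 h4
      have := hF.shape.anti j j' h1 h2.le
      rw [hin j c (by omega), hin j' c h4]; exact hF.col j j' c h1 h2 h3 h4
    · intro j c h
      rw [if_neg]
      rcases h with h | h | h
      · rw [hF.shape.zero j (Or.inl h)]; omega
      · rw [hF.shape.zero j (Or.inr h)]; omega
      · omega
    · dsimp only
      rw [hP]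
      ext q
      rw [mem_P, mem_P]
      constructor
      · rintro ⟨j, c, h1, h2, rfl⟩
        refine ⟨j, c, h1, h2, ?_⟩
        simp only [pos]; rw [hin j c h2]
      · rintro ⟨j, c, h1, h2, rfl⟩
        refine ⟨j, c, h1, h2, ?_⟩
        simp only [pos]; rw [hin j c h2]

end RCGraphs
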